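/- Let A be a core invertible (equivalently, dual core invertible) m × m complex matrix, and let (A_n) be a sequence of core invertible m × m complex matrices converging to A. The following statements are equivalent: (i) (A_n⊕) converges to A⊕; (ii) (A_n⊖) converges to A⊖; (iii) (A_n†) converges to A†; (iv) there exists n₀ such that rank(A_n) = rank(A) for all n ≥ n₀. -/

import Mathlib

open scoped Classical

/-- `x` is a Moore–Penrose inverse of `a`. -/
def IsMPInv {A : Type*} [Ring A] [StarRing A] (a x : A) : Prop :=
  a * x * a = a ∧ x * a * x = x ∧ star (a * x) = a * x ∧ star (x * a) = x * a

/-- `x` is a group inverse of `a`. -/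
def IsGroupInv {A : Type*} [Ring A] (a x : A) : Prop :=
  a * x * a = a ∧ x * a * x = x ∧ a * x = x * a

/-- `x` is a core inverse of `a`: `a·x·a = a`, `x·A = a·A`, `A·x = A·a*`. -/
def IsCoreInv {A : Type*} [Ring A] [StarRing A] (a x : A) : Prop :=
  a * x * a = a ∧ (Set.range fun y => x * y) = (Set.range fun y => a * y) ∧
    (Set.range fun y => y * x) = (Set.range fun y => y * star a)

/-- `x` is a dual core inverse of `a`: `a·x·a = a`, `x·A = a*·A`, `A·x = A·a`. -/
def IsDualCoreInv {A : Type*} [Ring A] [StarRing A] (a x : A) : Prop :=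
  a * x * a = a ∧ (Set.range fun y => x * y) = (Set.range fun y => star a * y) ∧
    (Set.range fun y => y * x) = (Set.range fun y => y * a)

/-- The Moore–Penrose inverse `a†` (or `0` if it does not exist). -/
noncomputable def mpInv {A : Type*} [Ring A] [StarRing A] (a : A) : A :=
  if h : ∃ x, IsMPInv a x then h.choose else 0

/-- The group inverse `a#` (or `0` if it does not exist). -/
noncomputable def groupInv {A : Type*} [Ring A] (a : A) : A :=
  if h : ∃ x, IsGroupInv a x then h.choose else 0

/-- The core inverse `a⊕` (or `0` if it does not exist). -/
noncomputable def coreInv {A : Type*} [Ring A] [StarRing A] (a : A) : A :=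
  if h : ∃ x, IsCoreInv a x then h.choose else 0

/-- The dual core inverse `a⊖` (or `0` if it does not exist). -/
noncomputable def dualCoreInv {A : Type*} [Ring A] [StarRing A] (a : A) : A :=
  if h : ∃ x, IsDualCoreInv a x then h.choose else 0

/-- The maximal angle `ψ_a ∈ [0, π/2]` between `a·a†` and `a†·a`, defined by
`sin ψ_a = ‖a·a† − a†·a‖` (and `ψ_a = 0` when `a = 0`). -/
noncomputable def maxAngle {A : Type*} [NormedRing A] [StarRing A] (a : A) : ℝ :=
  Real.arcsin ‖a * mpInv a - mpInv a * a‖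

/-- `δ(M, N)`: zero if `M = {0}`, otherwise the supremum of distances from
norm-one elements of `M` to `N`. -/
noncomputable def subDelta {E : Type*} [NormedAddCommGroup E] (M N : Set E) : ℝ :=
  if M = {0} then 0
  else sSup ((fun m => Metric.infDist m N) '' {m ∈ M | ‖m‖ = 1})

/-- The gap `θ(M, N)` between the subspaces `M` and `N`. -/
noncomputable def subGap {E : Type*} [NormedAddCommGroup E] (M N : Set E) : ℝ :=
  max (subDelta M N) (subDelta N M)

/-- The right ideal `a·A`. -/
def rIdeal {A : Type*} [Ring A] (a : A) : Set A := Set.range fun y => a * y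

/-- The left ideal `A·a`. -/
def lIdeal {A : Type*} [Ring A] (a : A) : Set A := Set.range fun y => y * a

/-- The right annihilator `a° = {x : a·x = 0}`. -/
def rAnn {A : Type*} [Ring A] (a : A) : Set A := {x | a * x = 0}

/-- The left annihilator `°a = {x : x·a = 0}`. -/
def lAnn {A : Type*} [Ring A] (a : A) : Set A := {x | x * a = 0}

section Ring

variable {R : Type*} [Ring R] [StarRing R] {a x y : R}

theorem IsCoreInv.isSelfAdjoint (h : IsCoreInv a x) : star (a * x) = a * x := by
  obtain ⟨h1, -, h3⟩ := h
  obtain ⟨y, hy⟩ : x ∈ Set.range fun y => y * star a := h3 ▸ ⟨1, one_mul x⟩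
  have hx : x = x * star (a * x) := by
    calc x = y * star (a * x * a) := by rw [h1]; exact hy.symm
      _ = (y * star a) * star (a * x) := by simp only [star_mul, mul_assoc]
      _ = x * star (a * x) := by rw [show y * star a = x from hy]
  have : a * x = (a * x) * star (a * x) := by
    rw [mul_assoc, ← hx]
  rw [this, star_mul, star_star]

theorem IsCoreInv.mul_mul_self (h : IsCoreInv a x) : x * a * x = x := by
  have hs := h.isSelfAdjoint
  obtain ⟨h1, -, h3⟩ := h
  obtain ⟨y, hy⟩ : x ∈ Set.range fun y => y * star a := h3 ▸ ⟨1, one_mul x⟩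
  calc x * a * x = x * star (a * x) := by rw [hs, mul_assoc]
    _ = y * star (a * x * a) := by
      conv_lhs => enter [1]; rw [← show y * star a = x from hy]
      simp only [star_mul, mul_assoc]
    _ = x := by rw [h1]; exact hy

theorem IsCoreInv.mul_sq (h : IsCoreInv a x) : x * a * a = a := by
  have hm := h.mul_mul_self
  obtain ⟨h1, h2, -⟩ := h
  obtain ⟨z, hz⟩ : a ∈ Set.range fun y => x * y := h2.symm ▸ ⟨1, mul_one a⟩
  calc x * a * a = x * a * x * z := by rw [mul_assoc _ x z, show x * z = a from hz]
    _ = a := by rw [hm]; exact hz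

theorem IsCoreInv.mul_mul_right (h : IsCoreInv a x) : a * x * x = x := by
  obtain ⟨h1, h2, -⟩ := h
  obtain ⟨y, hy⟩ : x ∈ Set.range fun y => a * y := h2 ▸ ⟨1, mul_one x⟩
  calc a * x * x = a * x * a * y := by rw [mul_assoc _ a y, show a * y = x from hy]
    _ = x := by rw [h1]; exact hy

theorem IsCoreInv.mul_eq_one (h : IsCoreInv a x) :
    (x + 1 - x * a) * (a + 1 - a * x) = 1 := by
  have h1 := h.mul_mul_right
  have h2 := h.mul_sq
  have h3 := h.mul_mul_self
  have h4 : x * a * (a * x) = a * x := by rw [← mul_assoc, h2]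
  have h5 : x * (a * x) = x := by rw [← mul_assoc, h3]
  simp only [mul_add, add_mul, mul_sub, sub_mul, mul_one, one_mul, h2, h4, h5]
  abel

theorem IsCoreInv.add_one_sub_mul (h : IsCoreInv a x) : (a + 1 - a * x) * x = a * x := by
  rw [sub_mul, add_mul, h.mul_mul_right, one_mul, add_sub_cancel_right]

theorem IsMPInv.mul_eq_one (h : IsMPInv a x) :
    (x * star x + 1 - x * a) * (star a * a + 1 - x * a) = 1 := by
  obtain ⟨h1, h2, h3, h4⟩ := h
  have e1 : x * star x * (star a * a) = x * a := by
    rw [show x * star x * (star a * a) = x * star (a * x) * a by simp only [star_mul, mul_assoc],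
      h3, ← mul_assoc, h2]
  have e2 : star x * (x * a) = star x := by
    rw [← h4, ← star_mul, h2]
  have e3 : x * a * (star a * a) = star a * a := by
    rw [← mul_assoc]
    congr 1
    rw [← h4, ← star_mul, ← mul_assoc, h1]
  have e4 : x * a * (x * a) = x * a := by rw [← mul_assoc, h2]
  have e5 : x * star x * (x * a) = x * star x := by rw [mul_assoc, e2]
  simp only [mul_add, add_mul, mul_sub, sub_mul, mul_one, one_mul, e1, e3, e4, e5]
  abel

theorem IsMPInv.add_one_sub_mul (h : IsMPInv a x) :
    (star a * a + 1 - x * a) * x = star a := by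
  obtain ⟨h1, h2, h3, -⟩ := h
  rw [sub_mul, add_mul, h2, one_mul, add_sub_cancel_right, mul_assoc, ← h3, ← star_mul, h1]

theorem IsDualCoreInv.isCoreInv_star (h : IsDualCoreInv a x) : IsCoreInv (star a) (star x) := by
  obtain ⟨h1, h2, h3⟩ := h
  have key (u v : R) (huv : Set.range (fun y => y * u) = Set.range fun y => y * v) :
      Set.range (fun y => star u * y) = Set.range fun y => star v * y := by
    have (u : R) : Set.range (fun y => star u * y) = star '' Set.range fun y => y * u := by
      ext w
      simp only [Set.mem_range, Set.mem_image, exists_exists_eq_and, star_mul]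
      exact ⟨fun ⟨y, hy⟩ => ⟨star y, by rwa [star_star]⟩, fun ⟨y, hy⟩ => ⟨star y, hy⟩⟩
    rw [this, this, huv]
  have key' (u v : R) (huv : Set.range (fun y => u * y) = Set.range fun y => v * y) :
      Set.range (fun y => y * star u) = Set.range fun y => y * star v := by
    have (u : R) : Set.range (fun y => y * star u) = star '' Set.range fun y => u * y := by
      ext w
      simp only [Set.mem_range, Set.mem_image, exists_exists_eq_and, star_mul]
      exact ⟨fun ⟨y, hy⟩ => ⟨star y, by rwa [star_star]⟩, fun ⟨y, hy⟩ => ⟨star y, hy⟩⟩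
    rw [this, this, huv]
  exact ⟨by rw [← star_mul, ← star_mul, ← mul_assoc, h1], key _ _ h3, key' _ _ h2⟩

theorem IsCoreInv.isDualCoreInv (h : IsCoreInv a x) (hy : IsMPInv a y) :
    IsDualCoreInv a (y * x * a) := by
  have c1 := h.1
  have c2 := h.mul_sq
  have c3 := h.mul_mul_right
  obtain ⟨h1, h2, h3, h4⟩ := hy
  have e1 : a * (y * x * a) = x * a := by
    calc a * (y * x * a) = a * y * x * a := by simp only [mul_assoc]
      _ = a * y * (a * x * x) * a := by rw [c3]
      _ = a * y * a * x * x * a := by simp only [mul_assoc]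
      _ = x * a := by rw [h1, c3]
  have e2 : y * x * a * a = star a * star y := by
    rw [← star_mul, h4, mul_assoc, mul_assoc, ← mul_assoc x, c2]
  have e3 : star a * (star y * (y * x * a)) = y * x * a := by
    rw [← mul_assoc, ← star_mul, h4, ← mul_assoc, ← mul_assoc, h2]
  have e4 : star a * star y * star a = star a := by
    rw [mul_assoc, ← star_mul, ← star_mul, h1]
  refine ⟨by rw [e1, c2], Set.Subset.antisymm ?_ ?_, Set.Subset.antisymm ?_ ?_⟩
  · rintro _ ⟨z, rfl⟩
    exact ⟨star y * (y * x * a) * z, by simp only [← mul_assoc] at e3 ⊢; rw [e3]⟩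
  · rintro _ ⟨z, rfl⟩
    exact ⟨a * star a * z, by simp only [← mul_assoc]; rw [e2, e4]⟩
  · rintro _ ⟨z, rfl⟩
    exact ⟨z * (y * x), by simp only [mul_assoc]⟩
  · rintro _ ⟨z, rfl⟩
    refine ⟨z * a * a, ?_⟩
    simp only [mul_assoc] at e1 c1 ⊢
    rw [e1, c1]

end Ring

section Matrix

open Filter Topology

variable {m : ℕ}

open scoped ComplexOrder in
theorem Matrix.exists_isMPInv (A : Matrix (Fin m) (Fin m) ℂ) : ∃ X, IsMPInv A X := by
  set H := star A * A with hH
  have hsa : IsSelfAdjoint H := IsSelfAdjoint.star_mul_self A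
  have hc (f : ℝ → ℝ) : ContinuousOn f (spectrum ℝ H) :=
    (Matrix.finite_real_spectrum (A := H)).continuousOn f
  set G := cfc (fun t : ℝ => t⁻¹) H with hG
  have hid : cfc (fun t : ℝ => t) H = H := cfc_id' ℝ H
  have hGs : star G = G := cfc_predicate (R := ℝ) (fun t : ℝ => t⁻¹) H
  have hHG : H * G = cfc (fun t : ℝ => t * t⁻¹) H := by
    rw [cfc_mul _ _ H (hc _) (hc _), hid]
  have hGH : G * H = cfc (fun t : ℝ => t⁻¹ * t) H := by
    rw [cfc_mul _ _ H (hc _) (hc _), hid]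
  have hHGH : H * (G * H) = H := by
    rw [hGH]
    conv_lhs => enter [1]; rw [← hid]
    rw [← cfc_mul _ _ H (hc _) (hc _)]
    conv_rhs => rw [← hid]
    congr 1
    ext t
    by_cases ht : t = 0 <;> simp [ht]
  have hGHG : G * H * G = G := by
    rw [hGH, hG, ← cfc_mul _ _ H (hc _) (hc _)]
    congr 1
    ext t
    by_cases ht : t = 0 <;> simp [ht]
  have hcomm : H * G = G * H := by
    rw [hHG, hGH]; simp only [mul_comm]
  have hA : A * (G * H) = A := by
    have : star (A * (G * H - 1)) * (A * (G * H - 1)) = 0 := by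
      have : star A * (A * (G * H - 1)) = 0 := by
        rw [← mul_assoc, ← hH, mul_sub, hHGH, mul_one, sub_self]
      rw [star_mul, mul_assoc, this, mul_zero]
    have := Matrix.conjTranspose_mul_self_eq_zero.1 this
    rwa [mul_sub, mul_one, sub_eq_zero] at this
  refine ⟨G * star A, ?_, ?_, ?_, ?_⟩
  · rw [mul_assoc, mul_assoc, ← hH, hA]
  · rw [mul_assoc G, ← hH, ← mul_assoc, hGHG]
  · rw [star_mul, star_mul, star_star, hGs, mul_assoc]
  · rw [mul_assoc, ← hH, star_mul, hGs, hsa.star_eq, hcomm]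

open scoped ComplexOrder in
theorem Matrix.rank_star (A : Matrix (Fin m) (Fin m) ℂ) : (star A).rank = A.rank :=
  A.rank_conjTranspose

theorem coreInv_spec {a : Matrix (Fin m) (Fin m) ℂ} (h : ∃ X, IsCoreInv a X) :
    IsCoreInv a (coreInv a) := by
  rw [coreInv, dif_pos h]; exact h.choose_spec

theorem mpInv_spec (a : Matrix (Fin m) (Fin m) ℂ) : IsMPInv a (mpInv a) := by
  rw [mpInv, dif_pos a.exists_isMPInv]; exact a.exists_isMPInv.choose_spec

theorem dualCoreInv_spec {a : Matrix (Fin m) (Fin m) ℂ} (h : ∃ X, IsCoreInv a X) :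
    IsDualCoreInv a (dualCoreInv a) := by
  have h' : ∃ X, IsDualCoreInv a X :=
    ⟨_, h.choose_spec.isDualCoreInv a.exists_isMPInv.choose_spec⟩
  rw [dualCoreInv, dif_pos h']; exact h'.choose_spec

theorem Matrix.trace_eq_rank_of_isIdempotentElem {P : Matrix (Fin m) (Fin m) ℂ} (h : P * P = P) :
    P.trace = P.rank := by
  have hi : IsIdempotentElem (Matrix.toLin' P) := by
    rw [IsIdempotentElem, Module.End.mul_eq_comp, ← Matrix.toLin'_mul, h]
  have := (LinearMap.IsIdempotentElem.isProj_range _ hi).trace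
  rw [Matrix.trace_toLin'_eq] at this
  rw [this, Matrix.rank, Matrix.toLin'_apply']

theorem Matrix.rank_mul_of_mul_mul_eq {A X : Matrix (Fin m) (Fin m) ℂ} (h : A * X * A = A) :
    (A * X).rank = A.rank := by
  refine le_antisymm (Matrix.rank_mul_le_left _ _) ?_
  conv_lhs => rw [← h]
  exact Matrix.rank_mul_le_left _ _

theorem Matrix.trace_mul_eq_rank {A X : Matrix (Fin m) (Fin m) ℂ} (h : A * X * A = A) :
    (A * X).trace = A.rank := by
  rw [Matrix.trace_eq_rank_of_isIdempotentElem (by rw [← mul_assoc, h]),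
    Matrix.rank_mul_of_mul_mul_eq h]

theorem Matrix.norm_apply_sq_le_trace (M : Matrix (Fin m) (Fin m) ℂ) (i j : Fin m) :
    ‖M i j‖ ^ 2 ≤ ‖(star M * M).trace‖ := by
  have h : (star M * M).trace = ((∑ j, ∑ i, ‖M i j‖ ^ 2 : ℝ) : ℂ) := by
    simp only [Matrix.trace, Matrix.diag, Matrix.mul_apply, Matrix.star_apply]
    push_cast
    refine Finset.sum_congr rfl fun j _ => Finset.sum_congr rfl fun i _ => ?_
    exact RCLike.conj_mul (M i j)
  rw [h, Complex.norm_real]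
  refine le_trans ?_ (le_abs_self _)
  calc ‖M i j‖ ^ 2 ≤ ∑ i, ‖M i j‖ ^ 2 :=
        Finset.single_le_sum (f := fun i => ‖M i j‖ ^ 2) (fun _ _ => by positivity)
          (Finset.mem_univ i)
    _ ≤ _ := Finset.single_le_sum (f := fun j => ∑ i, ‖M i j‖ ^ 2)
          (fun _ _ => by positivity) (Finset.mem_univ j)

theorem Matrix.tendsto_zero_of_trace {M : ℕ → Matrix (Fin m) (Fin m) ℂ}
    (h : Tendsto (fun n => (star (M n) * M n).trace) atTop (𝓝 0)) :
    Tendsto M atTop (𝓝 0) := by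
  refine tendsto_pi_nhds.2 fun i => tendsto_pi_nhds.2 fun j => ?_
  have h2 : Tendsto (fun n => ‖M n i j‖ ^ 2) atTop (𝓝 0) :=
    squeeze_zero (fun _ => by positivity) (fun n => (M n).norm_apply_sq_le_trace i j)
      (by simpa using h.norm)
  rw [Matrix.zero_apply, tendsto_zero_iff_norm_tendsto_zero]
  simpa using h2.sqrt

open scoped Matrix.Norms.L2Operator in
theorem IsStarProjection.tendsto_one_sub_mul {P B : ℕ → Matrix (Fin m) (Fin m) ℂ}
    (hP : ∀ n, IsStarProjection (P n)) (hB : Tendsto B atTop (𝓝 0)) :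
    Tendsto (fun n => (1 - P n) * B n) atTop (𝓝 0) := by
  refine squeeze_zero_norm (fun n => ?_) (by simpa using hB.norm)
  calc ‖(1 - P n) * B n‖ ≤ ‖1 - P n‖ * ‖B n‖ := norm_mul_le _ _
    _ ≤ 1 * ‖B n‖ := by gcongr; exact (hP n).one_sub.norm_le
    _ = ‖B n‖ := one_mul _

/-- If matrices of eventually constant rank converge, so do the orthogonal projections
onto their ranges. -/
theorem Matrix.tendsto_rangeProjection {A X : Matrix (Fin m) (Fin m) ℂ}
    {s x : ℕ → Matrix (Fin m) (Fin m) ℂ} (hs : Tendsto s atTop (𝓝 A))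
    (hA : A * X * A = A) (hA' : star (A * X) = A * X)
    (h : ∀ n, s n * x n * s n = s n) (h' : ∀ n, star (s n * x n) = s n * x n)
    (hr : ∃ n₀, ∀ n ≥ n₀, (s n).rank = A.rank) :
    Tendsto (fun n => s n * x n) atTop (𝓝 (A * X)) := by
  have hP (n) : IsStarProjection (s n * x n) :=
    ⟨by rw [IsIdempotentElem, ← mul_assoc, h], h' n⟩
  have hQ : IsStarProjection (A * X) := ⟨by rw [IsIdempotentElem, ← mul_assoc, hA], hA'⟩
  have h1 : Tendsto (fun n => (1 - s n * x n) * (A - s n)) atTop (𝓝 0) :=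
    IsStarProjection.tendsto_one_sub_mul hP (by simpa using hs.const_sub A)
  have h2 : Tendsto (fun n => (1 - s n * x n) * (A * X)) atTop (𝓝 0) := by
    have h3 := h1.mul_const X
    rw [zero_mul] at h3
    refine h3.congr fun n => ?_
    rw [mul_sub, sub_mul 1 _ (s n), h, one_mul, sub_self, sub_zero, mul_assoc]
  have h3 : Tendsto (fun n => 2 * ((1 - s n * x n) * (A * X)).trace) atTop (𝓝 0) := by
    have := ((Continuous.matrix_trace continuous_id).tendsto
      (0 : Matrix (Fin m) (Fin m) ℂ)).comp h2
    simpa using this.const_mul 2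
  have h4 : Tendsto (fun n => s n * x n - A * X) atTop (𝓝 0) := by
    refine Matrix.tendsto_zero_of_trace (h3.congr' ?_)
    obtain ⟨n₀, hn₀⟩ := hr
    filter_upwards [eventually_ge_atTop n₀] with n hn
    have t1 := Matrix.trace_mul_eq_rank (h n)
    have t2 := Matrix.trace_mul_eq_rank hA
    rw [hn₀ n hn, ← t2] at t1
    rw [star_sub, h', hA', sub_mul, one_mul, sub_mul, mul_sub, mul_sub, (hP n).isIdempotentElem.eq,
      hQ.isIdempotentElem.eq, Matrix.trace_sub, Matrix.trace_sub, Matrix.trace_sub,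
      Matrix.trace_sub, t1, Matrix.trace_mul_comm (A * X) (s n * x n)]
    ring
  simpa using h4.add_const (A * X)

theorem Matrix.eventually_rank_eq {A X : Matrix (Fin m) (Fin m) ℂ}
    {s x : ℕ → Matrix (Fin m) (Fin m) ℂ} (hs : Tendsto s atTop (𝓝 A))
    (hx : Tendsto x atTop (𝓝 X)) (hA : A * X * A = A) (h : ∀ n, s n * x n * s n = s n) :
    ∃ n₀, ∀ n ≥ n₀, (s n).rank = A.rank := by
  have h1 : Tendsto (fun n => (s n * x n).trace) atTop (𝓝 (A * X).trace) :=
    ((Continuous.matrix_trace continuous_id).tendsto (A * X)).comp (hs.mul hx)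
  simp only [Matrix.trace_mul_eq_rank hA, Matrix.trace_mul_eq_rank (h _)] at h1
  have h2 : Tendsto (fun n => (s n).rank) atTop (𝓝 A.rank) := by
    have h3 : Tendsto (fun n => ((s n).rank : ℝ)) atTop (𝓝 (A.rank : ℝ)) := by
      simpa [Function.comp_def] using (Complex.continuous_re.tendsto _).comp h1
    exact Nat.isClosedEmbedding_coe_real.isInducing.tendsto_nhds_iff.2 h3
  rw [nhds_discrete, tendsto_pure] at h2
  exact eventually_atTop.1 h2

theorem Matrix.tendsto_of_mul_eq {M L X B : Matrix (Fin m) (Fin m) ℂ}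
    {Mₙ Lₙ x b : ℕ → Matrix (Fin m) (Fin m) ℂ} (hM : Tendsto Mₙ atTop (𝓝 M))
    (hb : Tendsto b atTop (𝓝 B)) (hL : L * M = 1) (hLₙ : ∀ n, Lₙ n * Mₙ n = 1)
    (hX : M * X = B) (hx : ∀ n, Mₙ n * x n = b n) : Tendsto x atTop (𝓝 X) := by
  have hu : IsUnit M.det := (Matrix.isUnit_iff_isUnit_det M).1 (IsUnit.of_mul_eq_one_right _ hL)
  have hc : ContinuousAt Inv.inv M := by
    refine continuousAt_matrix_inv M ?_
    obtain ⟨u, hu⟩ := hu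
    rw [← hu]
    exact NormedRing.inverse_continuousAt u
  have h1 := (hc.tendsto.comp hM).mul hb
  have hxe : M⁻¹ * B = X := by
    rw [Matrix.inv_eq_left_inv hL, ← hX, ← mul_assoc, hL, one_mul]
  rw [hxe] at h1
  refine h1.congr fun n => ?_
  rw [Function.comp_apply, Matrix.inv_eq_left_inv (hLₙ n), ← hx, ← mul_assoc, hLₙ, one_mul]

theorem IsCoreInv.tendsto {A X : Matrix (Fin m) (Fin m) ℂ}
    {s x : ℕ → Matrix (Fin m) (Fin m) ℂ} (hs : Tendsto s atTop (𝓝 A))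
    (hA : IsCoreInv A X) (h : ∀ n, IsCoreInv (s n) (x n))
    (hr : ∃ n₀, ∀ n ≥ n₀, (s n).rank = A.rank) : Tendsto x atTop (𝓝 X) := by
  have hP := Matrix.tendsto_rangeProjection hs hA.1 hA.isSelfAdjoint (fun n => (h n).1)
    (fun n => (h n).isSelfAdjoint) hr
  exact Matrix.tendsto_of_mul_eq ((hs.add_const 1).sub hP) hP hA.mul_eq_one
    (fun n => (h n).mul_eq_one) hA.add_one_sub_mul (fun n => (h n).add_one_sub_mul)

theorem IsMPInv.tendsto {A X : Matrix (Fin m) (Fin m) ℂ}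
    {s x : ℕ → Matrix (Fin m) (Fin m) ℂ} (hs : Tendsto s atTop (𝓝 A))
    (hA : IsMPInv A X) (h : ∀ n, IsMPInv (s n) (x n))
    (hr : ∃ n₀, ∀ n ≥ n₀, (s n).rank = A.rank) : Tendsto x atTop (𝓝 X) := by
  have key {a y : Matrix (Fin m) (Fin m) ℂ} (hy : IsMPInv a y) :
      star a * star y = y * a := by rw [← star_mul, hy.2.2.2]
  have key₁ {a y : Matrix (Fin m) (Fin m) ℂ} (hy : IsMPInv a y) :
      star a * star y * star a = star a := by
    rw [mul_assoc, ← star_mul, ← star_mul, hy.1]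
  have key₂ {a y : Matrix (Fin m) (Fin m) ℂ} (hy : IsMPInv a y) :
      star (star a * star y) = star a * star y := by
    rw [key hy, hy.2.2.2]
  have hQ := Matrix.tendsto_rangeProjection hs.star (key₁ hA) (key₂ hA) (fun n => key₁ (h n))
    (fun n => key₂ (h n))
    (by simpa only [Matrix.rank_star] using hr)
  simp only [key hA, key (h _)] at hQ
  exact Matrix.tendsto_of_mul_eq (((hs.star.mul hs).add_const 1).sub hQ) hs.star hA.mul_eq_one
    (fun n => (h n).mul_eq_one) hA.add_one_sub_mul (fun n => (h n).add_one_sub_mul)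

theorem IsDualCoreInv.tendsto {A X : Matrix (Fin m) (Fin m) ℂ}
    {s x : ℕ → Matrix (Fin m) (Fin m) ℂ} (hs : Tendsto s atTop (𝓝 A))
    (hA : IsDualCoreInv A X) (h : ∀ n, IsDualCoreInv (s n) (x n))
    (hr : ∃ n₀, ∀ n ≥ n₀, (s n).rank = A.rank) : Tendsto x atTop (𝓝 X) := by
  have := IsCoreInv.tendsto hs.star hA.isCoreInv_star (fun n => (h n).isCoreInv_star)
    (by simpa only [Matrix.rank_star] using hr)
  simpa only [star_star] using this.star

end Matrix

theorem stmt18 {m : ℕ} (A : Matrix (Fin m) (Fin m) ℂ)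
    (hA : ∃ X, IsCoreInv A X)
    (s : ℕ → Matrix (Fin m) (Fin m) ℂ) (hs : ∀ n, ∃ X, IsCoreInv (s n) X)
    (hconv : Filter.Tendsto s Filter.atTop (nhds A)) :
    List.TFAE
      [Filter.Tendsto (fun n => coreInv (s n)) Filter.atTop (nhds (coreInv A)),
       Filter.Tendsto (fun n => dualCoreInv (s n)) Filter.atTop (nhds (dualCoreInv A)),
       Filter.Tendsto (fun n => mpInv (s n)) Filter.atTop (nhds (mpInv A)),
       ∃ n₀, ∀ n ≥ n₀, (s n).rank = A.rank] := by
  have hC := coreInv_spec hA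
  have hCs (n) := coreInv_spec (hs n)
  have hD := dualCoreInv_spec hA
  have hDs (n) := dualCoreInv_spec (hs n)
  have hM := mpInv_spec A
  have hMs (n) := mpInv_spec (s n)
  tfae_have 1 → 4 := fun h => Matrix.eventually_rank_eq hconv h hC.1 fun n => (hCs n).1
  tfae_have 2 → 4 := fun h => Matrix.eventually_rank_eq hconv h hD.1 fun n => (hDs n).1
  tfae_have 3 → 4 := fun h => Matrix.eventually_rank_eq hconv h hM.1 fun n => (hMs n).1
  tfae_have 4 → 1 := IsCoreInv.tendsto hconv hC hCs
  tfae_have 4 → 2 := IsDualCoreInv.tendsto hconv hD hDs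
  tfae_have 4 → 3 := IsMPInv.tendsto hconv hM hMs
  tfae_finish
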